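/- Let T be a regular interval exchange transformation on [ℓ,r) defined over a quadratic field ℚ[√d], normalized so that all endpoints and translation values lie in ℤ[√d]. Then there exist constants 0 < c ≤ C such that c ≤ Π(J) ≤ C for every semi-interval J admissible for T, where Π(J) = |J| · Ψ(J) is the reduced complexity (|J| the length of J and Ψ(J) = max of Ψ over the two endpoints, with Ψ(m + n√d) = max(|m|,|n|)). -/

import Mathlib

open Set

/-- An interval exchange transformation on `[l, r)` exchanging `s` half-open
intervals with boundaries `γ 0 = l < γ 1 < … < γ s = r`, translation values `α`,
and permutation `π` (ordering of the image intervals). -/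
structure IET (s : ℕ) where
  l : ℝ
  r : ℝ
  hlr : l < r
  γ : Fin (s + 1) → ℝ
  γ_mono : StrictMono γ
  γ_first : γ 0 = l
  γ_last : γ (Fin.last s) = r
  α : Fin s → ℝ
  π : Equiv.Perm (Fin s)
  T : ℝ → ℝ
  Tinv : ℝ → ℝ
  hT : ∀ i : Fin s, ∀ x ∈ Ico (γ i.castSucc) (γ i.succ), T x = x + α i
  hmaps : MapsTo T (Ico l r) (Ico l r)
  hinv_left : ∀ x ∈ Ico l r, Tinv (T x) = x
  hinv_right : ∀ x ∈ Ico l r, T (Tinv x) = x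
  hinvmaps : MapsTo Tinv (Ico l r) (Ico l r)
  himg_mono : StrictMono fun k : Fin s => γ (Fin.castSucc (π.symm k)) + α (π.symm k)

namespace IET

variable {s : ℕ} (X : IET s)

/-- The `i`-th exchanged interval `I_i`. -/
def I (i : Fin s) : Set ℝ := Ico (X.γ i.castSucc) (X.γ i.succ)

/-- The separation points `γ_1, …, γ_s` (left boundaries of the `I_i`). -/
def sep (i : Fin s) : ℝ := X.γ i.castSucc

/-- `δ i` : left boundary of the image interval `J_i = T(I_i)`. -/
def δ (i : Fin s) : ℝ := X.γ i.castSucc + X.α i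

/-- `ℤ`-iterate of the transformation. -/
def iter (n : ℤ) : ℝ → ℝ := if 0 ≤ n then (X.T)^[n.toNat] else (X.Tinv)^[(-n).toNat]

/-- The two-sided orbit of a point. -/
def orbit (z : ℝ) : Set ℝ := {y | ∃ n : ℤ, X.iter n z = y}

/-- Minimality: every orbit is dense in `[l, r)`. -/
def Minimal : Prop :=
  ∀ z ∈ Ico X.l X.r, ∀ y ∈ Ico X.l X.r, ∀ ε : ℝ, 0 < ε → ∃ w ∈ X.orbit z, |w - y| < ε

/-- Regularity (Keane's idoc condition): the orbits of the nonzero separation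
points are infinite and pairwise disjoint. -/
def Regular : Prop :=
  ∀ i j : Fin s, (i : ℕ) ≠ 0 → (j : ℕ) ≠ 0 → ∀ m n : ℤ,
    X.iter m (X.sep i) = X.iter n (X.sep j) → i = j ∧ m = n

/-- `I_w` : the set of points whose natural coding begins with the word `w`. -/
def Iw (X : IET s) : List (Fin s) → Set ℝ
  | [] => Ico X.l X.r
  | b :: w => X.I b ∩ X.T ⁻¹' (Iw X w)

/-- `J_w = T^{|w|}(I_w)`. -/
def Jw (w : List (Fin s)) : Set ℝ := (X.T)^[w.length] '' X.Iw w

/-- The factor set `F(T)` of the natural codings of `T`. -/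
def Fact : Set (List (Fin s)) := {w | (X.Iw w).Nonempty}

/-- First (positive) return time of `z` to the set `J`. -/
noncomputable def retTime (J : Set ℝ) (z : ℝ) : ℕ := sInf {n : ℕ | 0 < n ∧ (X.T)^[n] z ∈ J}

/-- First return map of `T` on the set `J`. -/
noncomputable def firstReturn (J : Set ℝ) (z : ℝ) : ℝ := (X.T)^[X.retTime J z] z

/-- `ρ⁺_{[u,v),T}(z) = min {n > 0 | T^n z ∈ (u,v)}`. -/
noncomputable def rhoP (u v z : ℝ) : ℕ := sInf {n : ℕ | 0 < n ∧ X.iter n z ∈ Ioo u v}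

/-- `ρ⁻_{[u,v),T}(z) = min {n ≥ 0 | T^{-n} z ∈ (u,v)}`. -/
noncomputable def rhoM (u v z : ℝ) : ℕ := sInf {n : ℕ | X.iter (-(n : ℤ)) z ∈ Ioo u v}

/-- The set of neighbors of `z` with respect to `[u,v)` and `T`. -/
def nbrs (u v z : ℝ) : Set ℝ :=
  {y | ∃ k : ℤ, -(X.rhoM u v z : ℤ) ≤ k ∧ k < (X.rhoP u v z : ℤ) ∧ X.iter k z = y}

/-- The set of division points of `[u,v)` with respect to `T`. -/
def Div (u v : ℝ) : Set ℝ := ⋃ i : Fin s, X.nbrs u v (X.sep i)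

/-- A semi-interval `[u,v) ⊆ [l,r)` is admissible for `T` if both of its
endpoints belong to `Div([u,v),T) ∪ {r}`. -/
def Admissible (u v : ℝ) : Prop :=
  X.l ≤ u ∧ u < v ∧ v ≤ X.r ∧ u ∈ X.Div u v ∧ (v ∈ X.Div u v ∨ v = X.r)

/-- `Y` is (a presentation of) the transformation induced by `X` on `[u,v)`:
its domain is `[u,v)`, it acts as the first return map of `X`, and its
separation points are the division points of `[u,v)` inside `[u,v)`. -/
def InducedOn (Y : IET s) (u v : ℝ) : Prop :=
  Y.l = u ∧ Y.r = v ∧ (∀ z ∈ Ico u v, Y.T z = X.firstReturn (Ico u v) z) ∧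
    {y | ∃ i : Fin s, Y.sep i = y} = X.Div u v ∩ Ico u v

end IET

/-- The ring `ℤ[√d] = {m + n√d : m, n ∈ ℤ}` inside `ℝ`. -/
def Zsd (d : ℕ) : Set ℝ := {x | ∃ m n : ℤ, x = (m : ℝ) + (n : ℝ) * Real.sqrt d}

/-- `Ψ(m + n√d) = max (|m|, |n|)` (the complexity of an element of `ℤ[√d]`). -/
noncomputable def Psi (d : ℕ) (x : ℝ) : ℝ :=
  sInf {t : ℝ | ∃ m n : ℤ, x = (m : ℝ) + (n : ℝ) * Real.sqrt d ∧ t = max |(m : ℝ)| |(n : ℝ)|}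

/-- `Ψ(X) = max {Ψ(z) : z ∈ ∂X}`, the complexity of a set. -/
noncomputable def PsiSet (d : ℕ) (S : Set ℝ) : ℝ := sSup (Psi d '' frontier S)

/-- Membership in the algebra `A([l,r))` of finite unions of half-open
intervals of `[l,r)` with endpoints in `ℤ[√d]`. -/
def InAlg (d : ℕ) (l r : ℝ) (S : Set ℝ) : Prop :=
  S ⊆ Set.Ico l r ∧ ∃ (n : ℕ) (e : Fin n → ℝ × ℝ),
    (∀ i, (e i).1 ∈ Zsd d ∧ (e i).2 ∈ Zsd d) ∧ S = ⋃ i, Set.Ico (e i).1 (e i).2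

/-- An interval exchange transformation is defined over `Q ⊆ ℝ` if all its
interval boundaries and translation values lie in `Q`. -/
def IET.DefinedOver {s : ℕ} (X : IET s) (Q : Set ℝ) : Prop :=
  (∀ i, X.γ i ∈ Q) ∧ ∀ i, X.α i ∈ Q


/-- `x = m + n√d` with both coefficients bounded by `B`. -/
def HC (d : ℕ) (x B : ℝ) : Prop :=
  ∃ m n : ℤ, x = (m : ℝ) + (n : ℝ) * Real.sqrt d ∧ |(m : ℝ)| ≤ B ∧ |(n : ℝ)| ≤ B

lemma HC.mono {d : ℕ} {x B B' : ℝ} (h : HC d x B) (hB : B ≤ B') : HC d x B' := by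
  obtain ⟨m, n, h1, h2, h3⟩ := h
  exact ⟨m, n, h1, h2.trans hB, h3.trans hB⟩

lemma HC.add {d : ℕ} {x y B B' : ℝ} (h : HC d x B) (h' : HC d y B') : HC d (x + y) (B + B') := by
  obtain ⟨m, n, h1, h2, h3⟩ := h
  obtain ⟨m', n', h1', h2', h3'⟩ := h'
  refine ⟨m + m', n + n', ?_, ?_, ?_⟩
  · push_cast; rw [h1, h1']; ring
  · push_cast; exact (abs_add_le _ _).trans (add_le_add h2 h2')
  · push_cast; exact (abs_add_le _ _).trans (add_le_add h3 h3')

lemma HC.neg {d : ℕ} {x B : ℝ} (h : HC d x B) : HC d (-x) B := by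
  obtain ⟨m, n, h1, h2, h3⟩ := h
  refine ⟨-m, -n, ?_, ?_, ?_⟩
  · push_cast; rw [h1]; ring
  · push_cast; rwa [abs_neg]
  · push_cast; rwa [abs_neg]

lemma HC.sub {d : ℕ} {x y B B' : ℝ} (h : HC d x B) (h' : HC d y B') : HC d (x - y) (B + B') := by
  rw [sub_eq_add_neg]; exact h.add h'.neg

lemma HC.psi_le {d : ℕ} {x B : ℝ} (h : HC d x B) : Psi d x ≤ B := by
  obtain ⟨m, n, h1, h2, h3⟩ := h
  have : Psi d x ≤ max |(m : ℝ)| |(n : ℝ)| := by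
    apply csInf_le
    · refine ⟨0, ?_⟩
      rintro t ⟨m, n, _, rfl⟩
      positivity
    · exact ⟨m, n, h1, rfl⟩
  exact this.trans (max_le h2 h3)

lemma sqrt_irr {d : ℕ} (hd : Squarefree d) (hd2 : 2 ≤ d) : ¬ IsSquare d := by
  rintro ⟨k, rfl⟩
  have := hd k (dvd_refl _)
  rw [Nat.isUnit_iff] at this
  subst this
  omega

lemma irr_sqrt {d : ℕ} (hd : ¬ IsSquare d) : Irrational (Real.sqrt d) := by
  exact irrational_sqrt_natCast_iff.2 hd

lemma rep_zero {d : ℕ} (hd : ¬ IsSquare d) {m n : ℤ} (h : (m : ℝ) + n * Real.sqrt d = 0) :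
    m = 0 ∧ n = 0 := by
  have hirr := irr_sqrt hd
  by_cases hn : n = 0
  · subst hn; simp at h; exact ⟨by exact_mod_cast h, rfl⟩
  · exfalso
    apply hirr
    refine ⟨(-m : ℚ) / n, ?_⟩
    push_cast
    have : (n : ℝ) ≠ 0 := by exact_mod_cast hn
    field_simp
    linarith

lemma hc_psi {d : ℕ} (hd : ¬ IsSquare d) {x : ℝ} (hx : x ∈ Zsd d) : HC d x (Psi d x) := by
  obtain ⟨m, n, h⟩ := hx
  have hs : {t : ℝ | ∃ m n : ℤ, x = (m : ℝ) + (n : ℝ) * Real.sqrt d ∧ t = max |(m : ℝ)| |(n : ℝ)|}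
      = {max |(m : ℝ)| |(n : ℝ)|} := by
    ext t
    simp only [Set.mem_ofPred_eq, Set.mem_singleton_iff]
    constructor
    · rintro ⟨m', n', h', rfl⟩
      have := rep_zero hd (m := m - m') (n := n - n') (by push_cast; linarith)
      have e1 : m = m' := by omega
      have e2 : n = n' := by omega
      rw [e1, e2]
    · rintro rfl
      exact ⟨m, n, h, rfl⟩
  have : Psi d x = max |(m : ℝ)| |(n : ℝ)| := by
    unfold Psi; rw [hs]; simp
  rw [this]
  exact ⟨m, n, h, le_max_left _ _, le_max_right _ _⟩

lemma HC.mem {d : ℕ} {x B : ℝ} (h : HC d x B) : x ∈ Zsd d := by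
  obtain ⟨m, n, h1, _⟩ := h
  exact ⟨m, n, h1⟩

lemma HC.nonneg {d : ℕ} {x B : ℝ} (h : HC d x B) : 0 ≤ B := by
  obtain ⟨m, n, _, h1, _⟩ := h
  exact (abs_nonneg _).trans h1

lemma HC.lower {d : ℕ} (hd : ¬ IsSquare d) {x B : ℝ} (h : HC d x B) (hx : 0 < x) :
    1 ≤ x * ((1 + Real.sqrt d) * B) := by
  obtain ⟨m, n, h1, h2, h3⟩ := h
  have hs : Real.sqrt d * Real.sqrt d = d := Real.mul_self_sqrt (by positivity)
  have hs0 : 0 ≤ Real.sqrt d := Real.sqrt_nonneg _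
  have hne : m * m - d * (n * n) ≠ 0 := by
    intro h0
    have h0' : (m : ℝ) * m - d * (n * n) = 0 := by exact_mod_cast h0
    have : ((m : ℝ) + n * Real.sqrt d) * ((m : ℝ) - n * Real.sqrt d) = 0 := by
      rw [← hs] at h0'; linarith
    rcases mul_eq_zero.1 this with h | h
    · rw [← h1] at h; linarith
    · have := rep_zero hd (m := m) (n := -n) (by push_cast; linarith)
      have e1 := this.1
      have e2 : n = 0 := by omega
      rw [e1, e2] at h1; simp at h1; linarith
  have h4 : (1 : ℝ) ≤ |(m : ℝ) * m - d * (n * n)| := by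
    have := Int.one_le_abs hne
    exact_mod_cast this
  have h5 : (m : ℝ) * m - d * (n * n) = x * ((m : ℝ) - n * Real.sqrt d) := by
    rw [h1]; linear_combination (n:ℝ)*n*hs
  rw [h5, abs_mul, abs_of_pos hx] at h4
  refine h4.trans (mul_le_mul_of_nonneg_left ?_ hx.le)
  calc |(m : ℝ) - n * Real.sqrt d| ≤ |(m : ℝ)| + |n * Real.sqrt d| := abs_sub _ _
    _ = |(m : ℝ)| + |(n : ℝ)| * Real.sqrt d := by rw [abs_mul, abs_of_nonneg hs0]
    _ ≤ B + B * Real.sqrt d := add_le_add h2 (mul_le_mul_of_nonneg_right h3 hs0)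
    _ = _ := by ring

/-- A piecewise translation of `[l,r)` over `ℤ[√d]`. -/
structure PT (d : ℕ) (l r : ℝ) (f g : ℝ → ℝ) (P : Finset ℝ) (u : ℝ) : Prop where
  fm : ∀ x ∈ Ico l r, f x ∈ Ico l r
  gm : ∀ x ∈ Ico l r, g x ∈ Ico l r
  gf : ∀ x ∈ Ico l r, g (f x) = x
  fg : ∀ x ∈ Ico l r, f (g x) = x
  pw : ∀ x ∈ Ico l r, ∀ y ∈ Ico l r, x ≤ y → (∀ p ∈ P, ¬ (x < p ∧ p ≤ y)) → f y - f x = y - x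
  tr : ∀ x ∈ Ico l r, HC d (f x - x) u
  hP : ∀ p ∈ P, HC d p u
  hl : HC d l u
  hr : HC d r u
  hu : 1 ≤ u

namespace PT

variable {d : ℕ} {l r : ℝ} {f g : ℝ → ℝ} {P : Finset ℝ} {u : ℝ}

lemma itm (h : PT d l r f g P u) (n : ℕ) {x : ℝ} (hx : x ∈ Ico l r) : f^[n] x ∈ Ico l r := by
  induction n with
  | zero => exact hx
  | succ n ih => rw [Function.iterate_succ_apply']; exact h.fm _ ih

lemma itgm (h : PT d l r f g P u) (n : ℕ) {x : ℝ} (hx : x ∈ Ico l r) : g^[n] x ∈ Ico l r := by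
  induction n with
  | zero => exact hx
  | succ n ih => rw [Function.iterate_succ_apply']; exact h.gm _ ih

lemma itgf (h : PT d l r f g P u) (n : ℕ) {x : ℝ} (hx : x ∈ Ico l r) : g^[n] (f^[n] x) = x := by
  induction n with
  | zero => rfl
  | succ n ih =>
    rw [Function.iterate_succ_apply' f, Function.iterate_succ_apply g, h.gf _ (h.itm n hx), ih]

lemma itfg (h : PT d l r f g P u) (n : ℕ) {x : ℝ} (hx : x ∈ Ico l r) : f^[n] (g^[n] x) = x := by
  induction n with
  | zero => rfl
  | succ n ih =>
    rw [Function.iterate_succ_apply' g, Function.iterate_succ_apply f, h.fg _ (h.itgm n hx), ih]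

lemma ittr (h : PT d l r f g P u) (n : ℕ) {x : ℝ} (hx : x ∈ Ico l r) :
    HC d (f^[n] x - x) (n * u) := by
  induction n with
  | zero => exact ⟨0, 0, by simp, by simp, by simp⟩
  | succ n ih =>
    rw [Function.iterate_succ_apply']
    have := (h.tr _ (h.itm n hx)).add ih
    convert this using 1
    · ring
    · push_cast; ring

/-- points whose orbit up to time m meets the second set -/
def G (l r : ℝ) (f : ℝ → ℝ) (P' : Finset ℝ) (m : ℕ) : Set ℝ :=
  {x | x ∈ Ico l r ∧ ∃ i ≤ m, f^[i] x ∈ P'}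

lemma G_finite (h : PT d l r f g P u) (P' : Finset ℝ) (m : ℕ) : (G l r f P' m).Finite := by
  apply Set.Finite.subset
    (((Finset.range (m + 1)) ×ˢ P').image (fun q : ℕ × ℝ => g^[q.1] q.2)).finite_toSet
  rintro x ⟨hx, i, hi, hp⟩
  simp only [Finset.coe_image, Set.mem_image]
  refine ⟨(i, f^[i] x), ?_, h.itgf i hx⟩
  simp [hp]; omega

lemma G_hc (h : PT d l r f g P u) {P' : Finset ℝ} {m : ℕ} {n0 : ℝ} (hP' : ∀ p ∈ P', HC d p n0)
    {x : ℝ} (hx : x ∈ G l r f P' m) : HC d x (n0 + m * u) := by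
  obtain ⟨hx, i, hi, hp⟩ := hx
  have := (hP' _ hp).sub (h.ittr i hx)
  simp only [sub_sub_cancel] at this
  refine this.mono ?_
  have : (i : ℝ) ≤ m := by exact_mod_cast hi
  have := h.hu
  gcongr

lemma iter_pw (h : PT d l r f g P u) {P' : Finset ℝ} (hPP : P ⊆ P') {m : ℕ} (i : ℕ) :
    i ≤ m + 1 → ∀ x ∈ Ico l r, ∀ y ∈ Ico l r, x ≤ y →
    (∀ p ∈ G l r f P' m, ¬ (x < p ∧ p ≤ y)) → f^[i] y - f^[i] x = y - x := by
  induction i with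
  | zero => intros; rfl
  | succ i ih =>
    intro hi x hx y hy hxy hG
    have e := ih (by omega) x hx y hy hxy hG
    rw [Function.iterate_succ_apply', Function.iterate_succ_apply', ← e]
    apply h.pw _ (h.itm i hx) _ (h.itm i hy) (by linarith)
    rintro p hp ⟨h1, h2⟩
    have hw : x + (p - f^[i] x) ∈ Ico l r := ⟨by linarith [hx.1], by linarith [hy.2]⟩
    have e2 := ih (by omega) x hx _ hw (by linarith)
      (fun q hq hq' => hG q hq ⟨hq'.1, by linarith [hq'.2]⟩)
    refine hG _ ⟨hw, i, by omega, ?_⟩ ⟨by linarith, by linarith⟩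
    have : f^[i] (x + (p - f^[i] x)) = p := by linarith
    rw [this]; exact hPP hp

lemma nocross (h : PT d l r f g P u) {P' : Finset ℝ} (hPP : P ⊆ P') {m : ℕ} {i : ℕ}
    (hi : i ≤ m) {x y : ℝ} (hx : x ∈ Ico l r) (hy : y ∈ Ico l r) (hxy : x ≤ y)
    (hG : ∀ p ∈ G l r f P' m, ¬ (x < p ∧ p ≤ y)) {p : ℝ} (hp : p ∈ P') :
    ¬ (f^[i] x < p ∧ p ≤ f^[i] y) := by
  rintro ⟨h1, h2⟩
  have e := h.iter_pw hPP i (by omega) x hx y hy hxy hG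
  have hw : x + (p - f^[i] x) ∈ Ico l r := ⟨by linarith [hx.1], by linarith [hy.2]⟩
  have e2 := h.iter_pw hPP i (by omega) x hx _ hw (by linarith)
      (fun q hq hq' => hG q hq ⟨hq'.1, by linarith [hq'.2]⟩)
  refine hG _ ⟨hw, i, by omega, ?_⟩ ⟨by linarith, by linarith⟩
  have : f^[i] (x + (p - f^[i] x)) = p := by linarith
  rw [this]; exact hp

lemma status (h : PT d l r f g P u) {P' : Finset ℝ} (hPP : P ⊆ P') {m : ℕ} {i : ℕ}
    (hi : i ≤ m) {x y : ℝ} (hx : x ∈ Ico l r) (hy : y ∈ Ico l r) (hxy : x ≤ y)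
    (hG : ∀ p ∈ G l r f P' m, ¬ (x < p ∧ p ≤ y)) {z1 z2 : ℝ} (hz1 : z1 ∈ P') (hz2 : z2 ∈ P') :
    f^[i] x ∈ Ico z1 z2 ↔ f^[i] y ∈ Ico z1 z2 := by
  have e := h.iter_pw hPP i (by omega) x hx y hy hxy hG
  have c1 := h.nocross hPP hi hx hy hxy hG hz1
  have c2 := h.nocross hPP hi hx hy hxy hG hz2
  have : f^[i] x ≤ f^[i] y := by linarith
  constructor
  · rintro ⟨a, b⟩
    refine ⟨by linarith, ?_⟩
    by_contra hc; exact c2 ⟨b, not_lt.1 hc⟩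
  · rintro ⟨a, b⟩
    refine ⟨?_, by linarith⟩
    by_contra hc; exact c1 ⟨not_le.1 hc, a⟩

/-- The continuity component around `z`. -/
lemma comp (h : PT d l r f g P u) {P' : Finset ℝ} (hl : l ∈ P') (m : ℕ)
    {z : ℝ} (hz : z ∈ Ico l r) :
    ∃ a b : ℝ, a ∈ G l r f P' m ∧ (b ∈ G l r f P' m ∨ b = r) ∧ a ≤ z ∧ z < b ∧ b ≤ r ∧
      (∀ p ∈ G l r f P' m, p ≤ a ∨ b ≤ p) := by
  have hfin := h.G_finite P' m
  have f1 : (G l r f P' m ∩ Iic z).Finite := hfin.subset inter_subset_left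
  have f2 : ((G l r f P' m ∪ {r}) ∩ Ioi z).Finite :=
    (hfin.union (Set.finite_singleton r)).subset inter_subset_left
  obtain ⟨a, ha, ha'⟩ := Set.exists_max_image _ id f1
    ⟨l, ⟨⟨le_refl l, hz.1.trans_lt hz.2⟩, 0, by omega, hl⟩, hz.1⟩
  obtain ⟨b, hb, hb'⟩ := Set.exists_min_image _ id f2 ⟨r, Or.inr rfl, hz.2⟩
  refine ⟨a, b, ha.1, hb.1, ha.2, hb.2, hb' r ⟨Or.inr rfl, hz.2⟩, ?_⟩
  intro p hp
  rcases le_or_gt p z with hpz | hpz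
  · left; exact ha' p ⟨hp, hpz⟩
  · right; exact hb' p ⟨Or.inl hp, hpz⟩

end PT

lemma log_sum_le (n0 : ℝ) (hn0 : 1 ≤ n0) (N : ℕ) :
    Real.log (n0 + N) - Real.log n0 ≤ ∑ m ∈ Finset.range N, 1 / (n0 + m) := by
  induction N with
  | zero => simp
  | succ N ih =>
    rw [Finset.sum_range_succ]
    have h1 : 0 < n0 + N := by positivity
    have h2 : 0 < n0 + (N + 1 : ℕ) := by positivity
    have h3 := Real.log_le_sub_one_of_pos (div_pos h2 h1)
    rw [Real.log_div h2.ne' h1.ne'] at h3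
    have h4 : (n0 + (N + 1 : ℕ)) / (n0 + N) - 1 = 1 / (n0 + N) := by
      push_cast
      field_simp
      ring
    linarith

lemma sum_len_le {l r : ℝ} (hlr : l ≤ r) (N : ℕ) (a b : ℕ → ℝ) (hab : ∀ m < N, a m ≤ b m)
    (hsub : ∀ m < N, Ico (a m) (b m) ⊆ Ico l r)
    (hdis : ∀ m < N, ∀ m' < N, m < m' → ∀ w, w ∈ Ico (a m) (b m) → w ∉ Ico (a m') (b m')) :
    ∑ m ∈ Finset.range N, (b m - a m) ≤ r - l := by
  have h1 : MeasureTheory.volume (⋃ m ∈ Finset.range N, Ico (a m) (b m))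
      = ∑ m ∈ Finset.range N, MeasureTheory.volume (Ico (a m) (b m)) := by
    apply MeasureTheory.measure_biUnion_finset
    · intro m hm m' hm' hne
      simp only [Finset.coe_range, Set.mem_Iio] at hm hm'
      rw [Function.onFun, Set.disjoint_left]
      intro w hw hw'
      rcases lt_or_gt_of_ne hne with h | h
      · exact hdis m hm m' hm' h w hw hw'
      · exact hdis m' hm' m hm h w hw' hw
    · intros; exact measurableSet_Ico
  have h2 : MeasureTheory.volume (⋃ m ∈ Finset.range N, Ico (a m) (b m))
      ≤ MeasureTheory.volume (Ico l r) := by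
    apply MeasureTheory.measure_mono
    intro w hw
    simp only [Set.mem_iUnion] at hw
    obtain ⟨m, hm, hw⟩ := hw
    exact hsub m (Finset.mem_range.1 hm) hw
  rw [h1] at h2
  simp only [Real.volume_Ico] at h2
  rw [← ENNReal.ofReal_sum_of_nonneg] at h2
  · exact (ENNReal.ofReal_le_ofReal_iff (by linarith)).1 h2
  · intro i hi
    linarith [hab i (Finset.mem_range.1 hi)]

namespace PT

variable {d : ℕ} {l r : ℝ} {f g : ℝ → ℝ} {P : Finset ℝ} {u : ℝ}

/-- Comparison of the orbits of two points of one component. -/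
lemma comp_iter (h : PT d l r f g P u) {P' : Finset ℝ} (hPP : P ⊆ P') {m : ℕ} {a b x z : ℝ}
    (hla : l ≤ a) (hbr : b ≤ r) (hG : ∀ p ∈ G l r f P' m, p ≤ a ∨ b ≤ p) (hx : x ∈ Ico a b)
    (hz : z ∈ Ico a b) {i : ℕ} (hi : i ≤ m) :
    f^[i] x = x + (f^[i] z - z) ∧ ∀ z1 ∈ P', ∀ z2 ∈ P',
      (f^[i] x ∈ Ico z1 z2 ↔ f^[i] z ∈ Ico z1 z2) := by
  have hx' : x ∈ Ico l r := ⟨hla.trans hx.1, hx.2.trans_le hbr⟩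
  have hz' : z ∈ Ico l r := ⟨hla.trans hz.1, hz.2.trans_le hbr⟩
  have hn : ∀ x ∈ Ico a b, ∀ z ∈ Ico a b, ∀ p ∈ G l r f P' m, ¬ (x < p ∧ p ≤ z) := by
    rintro x hx z hz p hp ⟨h1, h2⟩
    rcases hG p hp with h3 | h3
    · linarith [hx.1]
    · linarith [hz.2]
  rcases le_total x z with hxz | hxz
  · refine ⟨?_, fun z1 h1 z2 h2 => h.status hPP hi hx' hz' hxz (hn x hx z hz) h1 h2⟩
    have := h.iter_pw hPP i (by omega) x hx' z hz' hxz (hn x hx z hz)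
    linarith
  · refine ⟨?_, fun z1 h1 z2 h2 => (h.status hPP hi hz' hx' hxz (hn z hz x hx) h1 h2).symm⟩
    have := h.iter_pw hPP i (by omega) z hz' x hx' hxz (hn z hz x hx)
    linarith

/-- Linear bound on return times. -/
lemma ret (hd : ¬ IsSquare d) (hlr : l < r) (h : PT d l r f g P u) :
    ∃ K : ℝ, 1 ≤ K ∧ ∀ n0 : ℝ, 1 ≤ n0 → ∀ z1 z2 : ℝ, HC d z1 n0 → HC d z2 n0 →
      ∀ z ∈ Ico l r, z ∈ Ico z1 z2 → ∀ R : ℕ,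
      (∀ i, 1 ≤ i → i ≤ R → f^[i] z ∉ Ico z1 z2) → (R : ℝ) ≤ K * n0 := by
  have hu := h.hu
  have hs := Real.sqrt_nonneg (d : ℝ)
  set c : ℝ := 1 / (2 * u * (1 + Real.sqrt d)) with hc
  have hc0 : 0 < c := by positivity
  refine ⟨Real.exp ((r - l) / c), Real.one_le_exp (by
    have : 0 < r - l := by linarith
    positivity), ?_⟩
  intro n0 hn0 z1 z2 hz1 hz2 z hz hzJ R hR
  set P' : Finset ℝ := insert l (insert z1 (insert z2 P)) with hP'
  have hPP : P ⊆ P' := by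
    intro p hp; simp [hP', hp]
  have hlP : l ∈ P' := by simp [hP']
  have h1P : z1 ∈ P' := by simp [hP']
  have h2P : z2 ∈ P' := by simp [hP']
  have hu1 : u ≤ n0 * u := by nlinarith
  have hu2 : n0 ≤ n0 * u := by nlinarith
  have hHC : ∀ p ∈ P', HC d p (n0 * u) := by
    intro p hp
    simp only [hP', Finset.mem_insert] at hp
    rcases hp with rfl | rfl | rfl | hp
    · exact h.hl.mono hu1
    · exact hz1.mono hu2
    · exact hz2.mono hu2
    · exact (h.hP p hp).mono hu1
  have hcomp := fun m => h.comp hlP m hz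
  choose a b ha hb haz hzb hbr hG using hcomp
  have hla : ∀ m, l ≤ a m := fun m => (ha m).1.1
  have hlen : ∀ m : ℕ, c * (1 / (n0 + m)) ≤ b m - a m := by
    intro m
    have e1 := h.G_hc hHC (ha m)
    have e2 : HC d (b m) (n0 * u + m * u) := by
      rcases hb m with hb | hb
      · exact h.G_hc hHC hb
      · rw [hb]; refine h.hr.mono ?_
        have : 0 ≤ (m : ℝ) * u := by positivity
        linarith
    have e3 := (e2.sub e1).lower hd (by linarith [haz m, hzb m])
    have e4 : 0 < n0 + m := by positivity
    have e5 : c * (1 / (n0 + m)) = 1 / ((1 + Real.sqrt d) * (n0 * u + m * u + (n0 * u + m * u))) := by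
      rw [hc]; field_simp; ring
    rw [e5, div_le_iff₀ (by positivity)]
    exact e3
  have hzI : ∀ m, z ∈ Ico (a m) (b m) := fun m => ⟨haz m, hzb m⟩
  have key : ∀ m ≤ R, ∀ w ∈ Ico (a m + (f^[m] z - z)) (b m + (f^[m] z - z)),
      ∃ x ∈ Ico l r, f^[m] x = w ∧ x ∈ Ico z1 z2 ∧ ∀ i, 1 ≤ i → i ≤ m → f^[i] x ∉ Ico z1 z2 := by
    intro m hm w hw
    have hx : w - (f^[m] z - z) ∈ Ico (a m) (b m) := ⟨by linarith [hw.1], by linarith [hw.2]⟩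
    refine ⟨w - (f^[m] z - z), ⟨(hla m).trans hx.1, hx.2.trans_le (hbr m)⟩, ?_, ?_, ?_⟩
    · rw [(h.comp_iter hPP (hla m) (hbr m) (hG m) hx (hzI m) (le_refl m)).1]; ring
    · exact ((h.comp_iter hPP (hla m) (hbr m) (hG m) hx (hzI m) (Nat.zero_le m)).2
        z1 h1P z2 h2P).2 hzJ
    · intro i h1 h2 h3
      exact hR i h1 (h2.trans hm)
        (((h.comp_iter hPP (hla m) (hbr m) (hG m) hx (hzI m) h2).2 z1 h1P z2 h2P).1 h3)
  have hsum := sum_len_le hlr.le (R + 1) (fun m => a m + (f^[m] z - z))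
    (fun m => b m + (f^[m] z - z)) (fun m _ => by linarith [haz m, hzb m])
    (by
      intro m hm w hw
      obtain ⟨x, hx, rfl, -⟩ := key m (by omega) w hw
      exact h.itm m hx)
    (by
      intro m hm m' hm' hmm w hw hw'
      obtain ⟨x, hx, e, hxJ, -⟩ := key m (by omega) w hw
      obtain ⟨x', hx', e', -, hx'J⟩ := key m' (by omega) w hw'
      apply hx'J (m' - m) (by omega) (by omega)
      have e2 : f^[m] (f^[m' - m] x') = f^[m] x := by
        rw [← Function.iterate_add_apply, e, ← e']
        congr 2; omega
      have e3 := congrArg (g^[m]) e2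
      rw [h.itgf m (h.itm _ hx'), h.itgf m hx] at e3
      rwa [e3])
  have h1 : c * ∑ m ∈ Finset.range (R + 1), 1 / (n0 + (m : ℝ)) ≤ r - l := by
    rw [Finset.mul_sum]
    refine le_trans (Finset.sum_le_sum fun m _ => ?_) hsum
    have := hlen m
    linarith
  have h2 := log_sum_le n0 hn0 (R + 1)
  have h3 : Real.log (n0 + (R + 1 : ℕ)) - Real.log n0 ≤ (r - l) / c := by
    rw [le_div_iff₀ hc0]
    nlinarith
  have h4 : n0 + (R + 1 : ℕ) ≤ Real.exp ((r - l) / c) * n0 := by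
    have e1 : 0 < n0 + (R + 1 : ℕ) := by positivity
    have e2 : 0 < n0 := by linarith
    rw [← Real.log_div e1.ne' e2.ne', Real.log_le_iff_le_exp (by positivity), div_le_iff₀ e2] at h3
    exact h3
  push_cast at h4
  linarith

/-- A boundary point of the predicate `A`. -/
def Bd (l r : ℝ) (A : ℝ → Prop) (b : ℝ) : Prop :=
  l < b ∧ b < r ∧ ∃ x1, l ≤ x1 ∧ x1 < b ∧ ∀ x', x1 ≤ x' → x' < b → (A x' ↔ ¬ A b)

/-- Just left of `b` there is a point with no element of the finite set in between. -/
lemma left_free {S : Set ℝ} (hS : S.Finite) {b x1 : ℝ} (hx : x1 < b) :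
    ∃ x2, x1 ≤ x2 ∧ x2 < b ∧ ∀ p ∈ S, ¬ (x2 < p ∧ p < b) := by
  have hf : ((S ∪ {x1}) ∩ Iio b).Finite :=
    (hS.union (Set.finite_singleton _)).subset inter_subset_left
  obtain ⟨x2, h1, h2⟩ := Set.exists_max_image _ id hf ⟨x1, Or.inr rfl, hx⟩
  refine ⟨x2, h2 x1 ⟨Or.inr rfl, hx⟩, h1.2, ?_⟩
  rintro p hp ⟨h3, h4⟩
  have := h2 p ⟨Or.inl hp, h4⟩
  simp only [id] at this
  linarith

lemma Bd_step (h : PT d l r f g P u) {A : ℝ → Prop} (hA : ∀ x ∈ Ico l r, (A (f x) ↔ A x))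
    {b : ℝ} (hb : Bd l r A b) (hbP : b ∉ P) : Bd l r A (f b) := by
  obtain ⟨h1, h2, x1, h3, h4, h5⟩ := hb
  obtain ⟨x2, g1, g2, g3⟩ := left_free (S := (P : Set ℝ)) P.finite_toSet h4
  have hbI : b ∈ Ico l r := ⟨h1.le, h2⟩
  have hT : ∀ x', x2 ≤ x' → x' < b → f b - f x' = b - x' := by
    intro x' a1 a2
    apply h.pw x' ⟨by linarith, by linarith⟩ b hbI a2.le
    rintro p hp ⟨c1, c2⟩
    rcases c2.lt_or_eq with c2 | rfl
    · exact g3 p hp ⟨by linarith, c2⟩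
    · exact hbP hp
  have e := hT x2 le_rfl g2
  have m2 := h.fm x2 ⟨by linarith, by linarith⟩
  have mb := h.fm b hbI
  refine ⟨by linarith [m2.1], mb.2, f x2, m2.1, by linarith, ?_⟩
  intro y hy1 hy2
  have e2 := hT (b - (f b - y)) (by linarith) (by linarith)
  have e3 : f (b - (f b - y)) = y := by linarith
  have hI : b - (f b - y) ∈ Ico l r := ⟨by linarith, by linarith⟩
  rw [← e3, hA _ hI, hA b hbI]
  exact h5 _ (by linarith) (by linarith)

lemma Bd_orbit (h : PT d l r f g P u) {A : ℝ → Prop} (hA : ∀ x ∈ Ico l r, (A (f x) ↔ A x))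
    (hfin : {b | Bd l r A b}.Finite) (hper : ∀ x ∈ Ico l r, ∀ k ≥ 1, f^[k] x ≠ x)
    {b : ℝ} (hb : Bd l r A b) : ∃ n, f^[n] b ∈ P ∧ Bd l r A (f^[n] b) := by
  by_contra hcon
  push Not at hcon
  have hall : ∀ n, Bd l r A (f^[n] b) := by
    intro n
    induction n with
    | zero => exact hb
    | succ n ih =>
      rw [Function.iterate_succ_apply']
      exact h.Bd_step hA ih (fun hp => hcon n hp ih)
  have hlt : ∀ i j, i < j → f^[i] b = f^[j] b → False := by
    intro i j hij e
    apply hper (f^[i] b) (h.itm i ⟨hb.1.le, hb.2.1⟩) (j - i) (by omega)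
    rw [← Function.iterate_add_apply, e]
    congr 2; omega
  have hinj : Function.Injective (fun n => f^[n] b) := by
    intro i j e
    rcases lt_trichotomy i j with hij | hij | hij
    · exact (hlt i j hij e).elim
    · exact hij
    · exact (hlt j i hij e.symm).elim
  exact Set.infinite_of_injective_forall_mem hinj hall hfin

/-- Two points of different status are separated by a boundary point. -/
lemma exists_Bd {A : ℝ → Prop} {S : Set ℝ} (hS : S.Finite)
    (hA : ∀ x y, l ≤ x → x ≤ y → y < r → (∀ p ∈ S, ¬ (x < p ∧ p ≤ y)) → (A x ↔ A y))
    {x1 x2 : ℝ} (h1 : l ≤ x1) (h12 : x1 < x2) (h2 : x2 < r) (hne : ¬ (A x1 ↔ A x2)) :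
    ∃ b, Bd l r A b := by
  have aux : ∀ x, x1 ≤ x → x < r → ¬ (A x1 ↔ A x) →
      ∃ q ∈ S, x1 < q ∧ q ≤ x ∧ (A q ↔ A x) := by
    intro x hx hxr hn
    have hf : (S ∩ Ioc x1 x).Finite := hS.subset inter_subset_left
    have hne' : (S ∩ Ioc x1 x).Nonempty := by
      by_contra hc
      rw [Set.not_nonempty_iff_eq_empty] at hc
      apply hn
      apply hA x1 x h1 hx hxr
      intro p hp hp'
      have : p ∈ S ∩ Ioc x1 x := ⟨hp, hp'⟩
      rw [hc] at this; exact this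
    obtain ⟨q, q1, q2⟩ := Set.exists_max_image _ id hf hne'
    refine ⟨q, q1.1, q1.2.1, q1.2.2, ?_⟩
    apply hA q x (by linarith [q1.2.1]) q1.2.2 hxr
    rintro p hp ⟨p1, p2⟩
    have := q2 p ⟨hp, by linarith [q1.2.1], p2⟩
    simp only [id] at this
    linarith
  have hf : ({q | q ∈ S ∧ x1 < q ∧ q ≤ x2 ∧ ¬ (A x1 ↔ A q)}).Finite :=
    hS.subset (fun q hq => hq.1)
  obtain ⟨q0, a1, a2, a3, a4⟩ := aux x2 h12.le h2 hne
  obtain ⟨b, hb, hb'⟩ := Set.exists_min_image _ id hf ⟨q0, a1, a2, a3, by rwa [a4]⟩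
  obtain ⟨b1, b2, b3, b4⟩ := hb
  refine ⟨b, by linarith, by linarith, x1, h1, b2, ?_⟩
  intro x' hx1 hx2
  have : A x1 ↔ A x' := by
    by_contra hn
    obtain ⟨q, c1, c2, c3, c4⟩ := aux x' hx1 (by linarith) hn
    have := hb' q ⟨c1, c2, by linarith, by rwa [c4]⟩
    simp only [id] at this
    linarith
  tauto

/-- Every point hits `J` within the maximal return time. -/
lemma dense {Q : Finset ℝ} (hf : PT d l r f g P u) (hg : PT d l r g f Q u)
    (hper : ∀ x ∈ Ico l r, ∀ k ≥ 1, f^[k] x ≠ x)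
    (hkey : ∀ p ∈ P, l < p → ∀ m, g^[m] p ∉ Q)
    {z1 z2 : ℝ} (hz1 : l ≤ z1) (hz : z1 < z2) (hz2 : z2 ≤ r) (N : ℕ)
    (hF : ∀ z ∈ Ico l r, z ∈ Ico z1 z2 → ∃ i, 1 ≤ i ∧ f^[i] z ∈ Ico z1 z2)
    (hB : ∀ z ∈ Ico l r, z ∈ Ico z1 z2 → ∀ R : ℕ,
      (∀ i, 1 ≤ i → i ≤ R → g^[i] z ∉ Ico z1 z2) → R ≤ N) :
    ∀ x ∈ Ico l r, ∃ i ≤ N, f^[i] x ∈ Ico z1 z2 := by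
  classical
  set A : ℝ → Prop := fun x => ∀ i ≤ N, f^[i] x ∉ Ico z1 z2 with hAdef
  have hfull : ∀ x ∈ Ico l r, A x → ∀ i, f^[i] x ∉ Ico z1 z2 := by
    intro x hx hAx i hi
    have hex : ∃ i, f^[i] x ∈ Ico z1 z2 := ⟨i, hi⟩
    have hs := Nat.find_spec hex
    have hmin := fun m => Nat.find_min hex (m := m)
    set k := Nat.find hex
    have hk : k ≤ N := by
      apply hB (f^[k] x) (hf.itm k hx) hs k
      intro j hj1 hj2 hj3
      apply hmin (k - j) (by omega)
      have : f^[k] x = f^[j] (f^[k - j] x) := by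
        rw [← Function.iterate_add_apply]; congr 2; omega
      rw [this, hf.itgf j (hf.itm _ hx)] at hj3
      exact hj3
    exact hAx k hk hs
  have hA : ∀ x ∈ Ico l r, (A (f x) ↔ A x) := by
    intro x hx
    constructor
    · intro h i hi hJ
      have h' := hfull _ (hf.fm x hx) h
      rcases Nat.eq_zero_or_pos i with rfl | hi0
      · obtain ⟨j, hj1, hj2⟩ := hF x hx hJ
        apply h' (j - 1)
        rw [← Function.iterate_succ_apply]
        convert hj2 using 3; omega
      · apply h' (i - 1)
        rw [← Function.iterate_succ_apply]
        convert hJ using 3; omega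
    · intro h i hi
      rw [← Function.iterate_succ_apply]
      exact hfull x hx h _
  have hA' : ∀ x ∈ Ico l r, (A (g x) ↔ A x) := by
    intro x hx
    have := hA (g x) (hf.gm x hx)
    rw [hf.fg x hx] at this
    exact this.symm
  set P' : Finset ℝ := insert z1 (insert z2 P) with hP'
  have hPP : P ⊆ P' := by
    intro p hp; simp [hP', hp]
  have h1P : z1 ∈ P' := by simp [hP']
  have h2P : z2 ∈ P' := by simp [hP']
  have hSfin := hf.G_finite P' N
  have hloc : ∀ x y, l ≤ x → x ≤ y → y < r →
      (∀ p ∈ G l r f P' N, ¬ (x < p ∧ p ≤ y)) → (A x ↔ A y) := by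
    intro x y h1 h2 h3 h4
    have : ∀ i ≤ N, (f^[i] x ∈ Ico z1 z2 ↔ f^[i] y ∈ Ico z1 z2) := fun i hi =>
      hf.status hPP hi ⟨h1, by linarith⟩ ⟨by linarith, h3⟩ h2 h4 h1P h2P
    exact forall₂_congr fun i hi => not_congr (this i hi)
  have hBfin : {b | Bd l r A b}.Finite := by
    apply hSfin.subset
    rintro b ⟨b1, b2, x1, b3, b4, b5⟩
    by_contra hbG
    obtain ⟨x2, c1, c2, c3⟩ := left_free hSfin b4
    have e1 := b5 x2 c1 c2
    have e2 := hloc x2 b (by linarith) c2.le b2 (by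
      rintro p hp ⟨p1, p2⟩
      rcases p2.lt_or_eq with p2 | rfl
      · exact c3 p hp ⟨p1, p2⟩
      · exact hbG hp)
    tauto
  have hnoB : ∀ b, ¬ Bd l r A b := by
    intro b hb
    obtain ⟨n, hn1, hn2⟩ := hf.Bd_orbit hA hBfin hper hb
    obtain ⟨m, hm1, -⟩ := hg.Bd_orbit hA' hBfin (by
      intro x hx k hk e
      apply hper x hx k hk
      have := hf.itfg k hx
      rwa [e] at this) hn2
    exact hkey _ hn1 hn2.1 m hm1
  intro x hx
  by_contra hcon
  push Not at hcon
  have hAx : A x := hcon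
  have hAz : ¬ A z1 := fun h => h 0 (Nat.zero_le _) ⟨le_refl _, hz⟩
  have hneq : x ≠ z1 := by rintro rfl; exact hAz hAx
  rcases lt_or_gt_of_ne hneq with hlt | hlt
  · obtain ⟨b, hb⟩ := exists_Bd hSfin hloc hx.1 hlt (by linarith) (by tauto)
    exact hnoB b hb
  · obtain ⟨b, hb⟩ := exists_Bd hSfin hloc hz1 hlt hx.2 (by tauto)
    exact hnoB b hb

end PT

lemma pell_pow {d : ℕ} (hd : ¬ IsSquare d) (hd0 : 0 < d) :
    ∃ e : ℝ, 1 < e ∧ ∀ k : ℕ, ∃ A B : ℤ, (A : ℝ) + B * Real.sqrt d = e ^ k ∧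
      ((A : ℝ) + B * Real.sqrt d) * ((A : ℝ) - B * Real.sqrt d) = 1 := by
  have hs : Real.sqrt d * Real.sqrt d = d := Real.mul_self_sqrt (by positivity)
  have hsp : 0 < Real.sqrt d := Real.sqrt_pos.2 (by exact_mod_cast hd0)
  have hdz : ¬ IsSquare (d : ℤ) := by
    rintro ⟨k, hk⟩
    apply hd
    refine ⟨k.natAbs, ?_⟩
    zify
    rw [hk]; exact (abs_mul_abs_self k).symm
  obtain ⟨x, y, hxy, hy⟩ := Pell.exists_of_not_isSquare (by exact_mod_cast hd0) hdz
  have hx1 : 1 ≤ |x| := by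
    apply Int.one_le_abs
    rintro rfl
    have : 0 ≤ (d : ℤ) * y ^ 2 := by positivity
    nlinarith
  have hy1 : 1 ≤ |y| := Int.one_le_abs hy
  have hx1' : (1 : ℝ) ≤ (|x| : ℤ) := by exact_mod_cast hx1
  have hy1' : (1 : ℝ) ≤ (|y| : ℤ) := by exact_mod_cast hy1
  have hn : |x| * |x| - d * (|y| * |y|) = 1 := by
    rw [abs_mul_abs_self, abs_mul_abs_self]; linarith
  have hn' : ((|x| : ℤ) : ℝ) * (|x| : ℤ) - d * ((|y| : ℤ) * (|y| : ℤ)) = 1 := by exact_mod_cast hn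
  generalize |x| = a at *
  generalize |y| = b at *
  refine ⟨a + b * Real.sqrt d, by nlinarith, ?_⟩
  have hnn : ((a : ℝ) + b * Real.sqrt d) * ((a : ℝ) - b * Real.sqrt d) = 1 := by
    rw [← hn']; linear_combination (-(b : ℝ) * b) * hs
  intro k
  induction k with
  | zero => exact ⟨1, 0, by simp, by simp⟩
  | succ k ih =>
    obtain ⟨A, B, h1, h2⟩ := ih
    refine ⟨A * a + d * (B * b), A * b + B * a, ?_, ?_⟩
    · rw [pow_succ, ← h1]; push_cast
      linear_combination (-(B : ℝ) * b) * hs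
    · push_cast
      have e1 : (A : ℝ) * a + d * (B * b) + (A * b + B * a) * Real.sqrt d
          = (A + B * Real.sqrt d) * (a + b * Real.sqrt d) := by
        linear_combination (-(B : ℝ) * b) * hs
      have e2 : (A : ℝ) * a + d * (B * b) - (A * b + B * a) * Real.sqrt d
          = (A - B * Real.sqrt d) * (a - b * Real.sqrt d) := by
        linear_combination (-(B : ℝ) * b) * hs
      rw [e1, e2]
      linear_combination h2 * ((a : ℝ) + b * Real.sqrt d) * ((a : ℝ) - b * Real.sqrt d) + hnn

lemma approx {d : ℕ} (hd : ¬ IsSquare d) (hd0 : 0 < d) (R0 L : ℝ) (hR0 : 0 ≤ R0) (hL : 0 ≤ L) :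
    ∃ C1 : ℝ, 0 < C1 ∧ ∀ x : ℝ, |x| ≤ R0 → ∀ t : ℝ, 0 < t → t ≤ L →
      ∃ z : ℝ, |z - x| < t ∧ HC d z (C1 / t) := by
  obtain ⟨e, he, hpow⟩ := pell_pow hd hd0
  have hs : Real.sqrt d * Real.sqrt d = d := Real.mul_self_sqrt (by positivity)
  have hs1 : 1 ≤ Real.sqrt d := by
    rw [Real.one_le_sqrt]; exact_mod_cast hd0
  set h : ℝ := (1 + Real.sqrt d) / 2 with hh
  have hh0 : 0 < h := by positivity
  refine ⟨(R0 + L + e * h) * L + e * h * h, by positivity, ?_⟩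
  intro x hx t ht htL
  obtain ⟨n0, hk1, hk2⟩ := exists_nat_pow_near (x := 1 + h / t) (y := e)
    (by have : 0 < h / t := by positivity
        linarith) he
  obtain ⟨A, B, hAB, hun⟩ := hpow (n0 + 1)
  have hE1 : e ^ (n0 + 1) ≤ e * (1 + h / t) := by
    rw [pow_succ, mul_comm]; gcongr
  set E := e ^ (n0 + 1) with hE
  have hE0 : 0 < E := by positivity
  rw [hAB] at hun
  set F : ℝ := (A : ℝ) - B * Real.sqrt d with hF
  have hF' : F = 1 / E := by field_simp; linarith
  have hF0 : 0 < F := by rw [hF']; positivity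
  set X := E * x with hX
  set m : ℤ := round (X / 2) with hm
  set n : ℤ := round (X / (2 * Real.sqrt d)) with hn
  have r1 : |X / 2 - m| ≤ 1 / 2 := abs_sub_round _
  have r2 : |X / (2 * Real.sqrt d) - n| ≤ 1 / 2 := abs_sub_round _
  have r2' : |X / 2 - n * Real.sqrt d| ≤ Real.sqrt d / 2 := by
    have : X / 2 - n * Real.sqrt d = (X / (2 * Real.sqrt d) - n) * Real.sqrt d := by
      field_simp
    rw [this, abs_mul, abs_of_nonneg (by linarith : 0 ≤ Real.sqrt d)]
    have := mul_le_mul_of_nonneg_right r2 (by linarith : 0 ≤ Real.sqrt d)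
    linarith
  rw [abs_le] at r1 r2'
  have w1 : |(m : ℝ) + n * Real.sqrt d - X| ≤ h := by
    rw [abs_le]; constructor <;> linarith [r1.1, r1.2, r2'.1, r2'.2]
  have w2 : |(m : ℝ) - n * Real.sqrt d| ≤ h := by
    rw [abs_le]; constructor <;> linarith [r1.1, r1.2, r2'.1, r2'.2]
  set z : ℝ := ((m : ℝ) + n * Real.sqrt d) * F with hz
  set z' : ℝ := ((m : ℝ) - n * Real.sqrt d) * E with hz'
  have d1 : |z - x| < t := by
    have : z - x = ((m : ℝ) + n * Real.sqrt d - X) * F := by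
      rw [hz, hX]; linear_combination x * hun
    rw [this, abs_mul, abs_of_pos hF0]
    have : h * F < t := by
      rw [hF', mul_one_div, div_lt_iff₀ hE0]
      have : h / t < E := by linarith
      rw [div_lt_iff₀ ht] at this
      linarith
    exact lt_of_le_of_lt (mul_le_mul_of_nonneg_right w1 hF0.le) this
  have d2 : |z'| ≤ e * (1 + h / t) * h := by
    rw [hz', abs_mul, abs_of_pos hE0]
    calc |(m : ℝ) - n * Real.sqrt d| * E ≤ h * E := mul_le_mul_of_nonneg_right w2 hE0.le
      _ = E * h := mul_comm _ _
      _ ≤ _ := mul_le_mul_of_nonneg_right hE1 hh0.le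
  have d3 : |z| ≤ R0 + L := by
    have : |z| ≤ |z - x| + |x| := by
      have := abs_add_le (z - x) x
      simpa using this
    linarith
  have d4 : |z| + |z'| ≤ ((R0 + L + e * h) * L + e * h * h) / t := by
    have e1 : ((R0 + L + e * h) * L + e * h * h) / t
        = (R0 + L + e * h) * (L / t) + e * (h / t) * h := by field_simp
    have e2 : 1 ≤ L / t := by rw [le_div_iff₀ ht]; linarith
    have e3 : (R0 + L + e * h) * 1 ≤ (R0 + L + e * h) * (L / t) := by gcongr
    have e4 : e * (1 + h / t) * h = e * h + e * (h / t) * h := by ring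
    rw [e1]
    rw [e4] at d2
    linarith
  refine ⟨z, d1, m * A - d * (n * B), n * A - m * B, ?_, ?_, ?_⟩
  · push_cast
    rw [hz, hF]
    linear_combination (-(n : ℝ) * B) * hs
  · refine le_trans ?_ d4
    have : (((m * A - d * (n * B) : ℤ)) : ℝ) = (z + z') / 2 := by
      push_cast; rw [hz, hz', hF, ← hAB]
      linear_combination ((n : ℝ) * B) * hs
    rw [this, abs_div, abs_two]
    have := abs_add_le z z'
    have := abs_nonneg (z + z')
    linarith
  · refine le_trans ?_ d4
    have : (((n * A - m * B : ℤ)) : ℝ) * Real.sqrt d = (z - z') / 2 := by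
      push_cast; rw [hz, hz', hF, ← hAB]
      ring
    have h3 : |(((n * A - m * B : ℤ)) : ℝ)| * Real.sqrt d ≤ |z| + |z'| := by
      have h4 : |(((n * A - m * B : ℤ)) : ℝ)| * Real.sqrt d
          = |(((n * A - m * B : ℤ)) : ℝ) * Real.sqrt d| := by
        rw [abs_mul, abs_of_nonneg (by linarith : (0 : ℝ) ≤ Real.sqrt d)]
      rw [h4, this, abs_div, abs_two]
      have := abs_sub z z'
      have := abs_nonneg (z - z')
      linarith
    have h5 := abs_nonneg (((n * A - m * B : ℤ)) : ℝ)
    exact (le_mul_of_one_le_right h5 hs1).trans h3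

namespace IET

variable {s : ℕ} (X : IET s)

lemma iter_nat (n : ℕ) : X.iter (n : ℤ) = X.T^[n] := by
  simp [iter]

lemma iter_neg (n : ℕ) : X.iter (-(n : ℤ)) = X.Tinv^[n] := by
  rcases Nat.eq_zero_or_pos n with rfl | hn
  · simp [iter]
  · unfold iter
    rw [if_neg (by omega)]
    simp

lemma locate {x : ℝ} (hx : x ∈ Ico X.l X.r) :
    ∃ i : Fin s, x ∈ Ico (X.γ i.castSucc) (X.γ i.succ) := by
  by_contra hcon
  push Not at hcon
  have : ∀ i : Fin (s + 1), X.γ i ≤ x := by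
    intro i
    induction i using Fin.induction with
    | zero => rw [X.γ_first]; exact hx.1
    | succ i ih =>
      by_contra h
      exact hcon i ⟨ih, not_le.1 h⟩
  have := this (Fin.last s)
  rw [X.γ_last] at this
  linarith [hx.2]

lemma γ_mem (i : Fin (s + 1)) : X.l ≤ X.γ i ∧ X.γ i ≤ X.r := by
  rw [← X.γ_first, ← X.γ_last]
  exact ⟨X.γ_mono.monotone (Fin.zero_le _), X.γ_mono.monotone (Fin.le_last _)⟩

lemma sep_mem (i : Fin s) : X.sep i ∈ Ico X.l X.r := by
  refine ⟨(X.γ_mem _).1, ?_⟩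
  have : X.γ i.castSucc < X.γ i.succ := X.γ_mono (Fin.castSucc_lt_succ)
  exact this.trans_le (X.γ_mem _).2

lemma sep_I (i : Fin s) : X.sep i ∈ Ico (X.γ i.castSucc) (X.γ i.succ) :=
  ⟨le_rfl, X.γ_mono (Fin.castSucc_lt_succ)⟩

lemma T_sep (i : Fin s) : X.T (X.sep i) = X.sep i + X.α i := X.hT i _ (X.sep_I i)

lemma I_sub (i : Fin s) {x : ℝ} (hx : x ∈ Ico (X.γ i.castSucc) (X.γ i.succ)) :
    x ∈ Ico X.l X.r := ⟨(X.γ_mem _).1.trans hx.1, hx.2.trans_le (X.γ_mem _).2⟩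

/-- The separation points. -/
noncomputable def SP : Finset ℝ := Finset.univ.image X.sep

/-- The images of the separation points. -/
noncomputable def SQ : Finset ℝ := Finset.univ.image (fun i => X.T (X.sep i))

lemma exists_PT {d : ℕ} (hd : ¬ IsSquare d) (hdef : X.DefinedOver (Zsd d)) :
    ∃ u : ℝ, PT d X.l X.r X.T X.Tinv X.SP u ∧ PT d X.l X.r X.Tinv X.T X.SQ u := by
  obtain ⟨u1, hu1⟩ := (Set.finite_range (fun i => Psi d (X.γ i))).bddAbove
  obtain ⟨u2, hu2⟩ := (Set.finite_range (fun i => Psi d (X.α i))).bddAbove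
  set u := 1 + |u1| + |u2| with hu
  have a1 := le_abs_self u1
  have a2 := le_abs_self u2
  have a3 := abs_nonneg u1
  have a4 := abs_nonneg u2
  have hγ : ∀ i, HC d (X.γ i) |u1| := fun i =>
    (hc_psi hd (hdef.1 i)).mono ((hu1 ⟨i, rfl⟩).trans (by linarith))
  have hα : ∀ i, HC d (X.α i) |u2| := fun i =>
    (hc_psi hd (hdef.2 i)).mono ((hu2 ⟨i, rfl⟩).trans (by linarith))
  have hl : HC d X.l u := by rw [← X.γ_first]; exact (hγ _).mono (by linarith)
  have hr : HC d X.r u := by rw [← X.γ_last]; exact (hγ _).mono (by linarith)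
  have htr : ∀ x ∈ Ico X.l X.r, HC d (X.T x - x) u := by
    intro x hx
    obtain ⟨i, hi⟩ := X.locate hx
    rw [X.hT i x hi, add_sub_cancel_left]
    exact (hα i).mono (by linarith)
  refine ⟨u, ⟨X.hmaps, X.hinvmaps, X.hinv_left, X.hinv_right, ?_, htr, ?_, hl, hr, by linarith⟩,
    ⟨X.hinvmaps, X.hmaps, X.hinv_right, X.hinv_left, ?_, ?_, ?_, hl, hr, by linarith⟩⟩
  · intro x hx y hy hxy hP
    obtain ⟨j, hj⟩ := X.locate hy
    have hxj : x ∈ Ico (X.γ j.castSucc) (X.γ j.succ) := by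
      refine ⟨?_, by linarith [hj.2]⟩
      by_contra hc
      exact hP (X.sep j) (by simp [SP]) ⟨not_le.1 hc, hj.1⟩
    rw [X.hT j x hxj, X.hT j y hj]; ring
  · intro p hp
    simp only [SP, Finset.mem_image] at hp
    obtain ⟨i, -, rfl⟩ := hp
    exact (hγ _).mono (by linarith)
  · intro x hx y hy hxy hQ
    obtain ⟨j, hj⟩ := X.locate (X.hinvmaps hy)
    have e1 := X.hT j _ hj
    rw [X.hinv_right y hy] at e1
    have h1 : X.sep j + X.α j ≤ x := by
      by_contra hc
      refine hQ (X.T (X.sep j)) (by simp [SQ]) ⟨?_, ?_⟩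
      · rw [X.T_sep]; exact not_le.1 hc
      · rw [X.T_sep, e1]; have := hj.1; unfold sep; linarith
    have hx' : x - X.α j ∈ Ico (X.γ j.castSucc) (X.γ j.succ) := by
      refine ⟨?_, ?_⟩
      · unfold sep at h1; linarith
      · linarith [hj.2]
    have e2 := X.hT j _ hx'
    have e3 := X.hinv_left _ (X.I_sub j hx')
    rw [e2, sub_add_cancel] at e3
    rw [e3]; linarith
  · intro x hx
    have := (htr _ (X.hinvmaps hx)).neg
    rw [X.hinv_right x hx, neg_sub] at this
    exact this
  · intro p hp
    simp only [SQ, Finset.mem_image] at hp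
    obtain ⟨i, -, rfl⟩ := hp
    rw [X.T_sep]
    exact ((hγ _).add (hα i)).mono (by linarith)

/-- a separation point mapped to the left of the image of its preimage interval -/
lemma sep_preimage {y : ℝ} (hy : y ∈ Ico X.l X.r) :
    ∃ j : Fin s, X.T (X.sep j) ≤ y ∧ X.Tinv y ∈ Ico (X.γ j.castSucc) (X.γ j.succ) ∧
      (X.T (X.sep j) = y ↔ X.Tinv y = X.sep j) := by
  obtain ⟨j, hj⟩ := X.locate (X.hinvmaps hy)
  have e1 := X.hT j _ hj
  rw [X.hinv_right y hy] at e1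
  refine ⟨j, ?_, hj, ?_⟩
  · rw [X.T_sep, e1]; have := hj.1; unfold sep; linarith
  · rw [X.T_sep]; constructor <;> intro h <;> linarith

lemma sep_zero (i : Fin s) (hi : (i : ℕ) = 0) : X.sep i = X.l := by
  unfold sep; rw [← X.γ_first]; congr 1; ext; simpa using hi

lemma exists_l (hs : 2 ≤ s) (hreg : X.Regular) :
    ∃ j : Fin s, (j : ℕ) ≠ 0 ∧ X.T (X.sep j) = X.l := by
  obtain ⟨j, h1, h2, h3⟩ := X.sep_preimage (y := X.l) ⟨le_rfl, X.hlr⟩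
  have e1 : X.T (X.sep j) = X.l := le_antisymm h1 (X.hmaps (X.sep_mem j)).1
  refine ⟨j, ?_, e1⟩
  intro hj0
  have e2 := X.sep_zero j hj0
  have e3 := X.T_sep j
  rw [e1, e2] at e3
  have hα : X.α j = 0 := by linarith
  -- the first separation point
  let k : Fin s := ⟨1, by omega⟩
  have hk : X.sep k = X.γ j.succ := by
    unfold sep; congr 1; ext; simp [k, hj0]
  obtain ⟨i, c1, c2, c3⟩ := X.sep_preimage (X.sep_mem k)
  have hfix : ∀ x, x ∈ Ico X.l (X.sep k) → X.T x = x := by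
    intro x hx
    have := X.hT j x ⟨by have := X.sep_zero j hj0; unfold sep at this; rw [this]; exact hx.1,
      by rw [← hk]; exact hx.2⟩
    rw [this, hα, add_zero]
  have hi0 : (i : ℕ) ≠ 0 := by
    intro hi0
    have hij : i = j := by ext; omega
    subst hij
    have hlt := c2.2
    rw [← hk] at hlt
    have := hfix _ ⟨(X.hinvmaps (X.sep_mem k)).1, hlt⟩
    rw [X.hinv_right _ (X.sep_mem k)] at this
    linarith
  have hik : X.sep k ≤ X.sep i := by
    unfold sep
    apply X.γ_mono.monotone
    rw [Fin.le_def]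
    simp [k]; omega
  have e4 : X.T (X.sep i) = X.sep k := by
    rcases c1.lt_or_eq with hlt | h
    · exfalso
      have hm := X.hmaps (X.sep_mem i)
      have := hfix _ ⟨hm.1, hlt⟩
      have h5 := congrArg X.Tinv this
      rw [X.hinv_left _ hm, X.hinv_left _ (X.sep_mem i)] at h5
      linarith
    · exact h
  have := hreg i k hi0 (by simp [k]) 1 0 (by
    have a := X.iter_nat 1
    have b := X.iter_nat 0
    simp only [Nat.cast_one, Nat.cast_zero] at a b
    rw [a, b]; simpa using e4)
  omega

lemma nonper {d : ℕ} {u : ℝ} (hs : 2 ≤ s) (hreg : X.Regular)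
    (h : PT d X.l X.r X.T X.Tinv X.SP u) :
    ∀ x ∈ Ico X.l X.r, ∀ k ≥ 1, X.T^[k] x ≠ x := by
  intro x hx k hk e
  have hns : ∀ i : Fin s, (i : ℕ) ≠ 0 → X.T^[k] (X.sep i) ≠ X.sep i := by
    intro i hi e
    have := (hreg i i hi hi k 0 (by
      rw [X.iter_nat]
      have b := X.iter_nat 0
      simp only [Nat.cast_zero] at b
      rw [b]; exact e)).2
    omega
  have hl : X.l ∈ X.SP := by
    simp only [SP, Finset.mem_image]
    exact ⟨⟨0, by omega⟩, Finset.mem_univ _, X.sep_zero _ rfl⟩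
  obtain ⟨a, b, ha, hb, h1, h2, h3, h4⟩ := h.comp hl k hx
  have e1 := (h.comp_iter (Finset.Subset.refl _) ha.1.1 h3 h4 (x := a) (z := x)
    ⟨le_rfl, by linarith⟩ ⟨h1, h2⟩ (le_refl k)).1
  rw [e, sub_self, add_zero] at e1
  obtain ⟨haI, i, hi, hp⟩ := ha
  have e2 : X.T^[k] (X.T^[i] a) = X.T^[i] a := by
    rw [← Function.iterate_add_apply, add_comm, Function.iterate_add_apply, e1]
  generalize X.T^[i] a = p at *
  simp only [SP, Finset.mem_image] at hp
  obtain ⟨j, -, rfl⟩ := hp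
  by_cases hj : (j : ℕ) = 0
  · obtain ⟨q, hq, eq⟩ := X.exists_l hs hreg
    rw [X.sep_zero j hj, ← eq, ← Function.iterate_succ_apply, Function.iterate_succ_apply'] at e2
    have := congrArg X.Tinv e2
    rw [X.hinv_left _ (h.itm k (X.sep_mem q)), X.hinv_left _ (X.sep_mem q)] at this
    exact hns q hq this
  · exact hns j hj e2

lemma noconn {d : ℕ} {u : ℝ} (hs : 2 ≤ s) (hreg : X.Regular)
    (h : PT d X.l X.r X.T X.Tinv X.SP u) :
    ∀ p ∈ X.SP, X.l < p → ∀ m, X.Tinv^[m] p ∉ X.SQ := by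
  intro p hp hlp m hm
  simp only [SP, Finset.mem_image] at hp
  obtain ⟨i, -, rfl⟩ := hp
  simp only [SQ, Finset.mem_image] at hm
  obtain ⟨j, -, hj⟩ := hm
  have hi : (i : ℕ) ≠ 0 := fun h0 => by rw [X.sep_zero i h0] at hlp; linarith
  have hns : ∀ k : Fin s, (k : ℕ) ≠ 0 → ∀ n : ℕ, X.Tinv^[n + 1] (X.sep i) ≠ X.sep k := by
    intro k hk n e
    have := (hreg i k hi hk (-((n + 1 : ℕ) : ℤ)) 0 (by
      rw [X.iter_neg]
      have b := X.iter_nat 0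
      simp only [Nat.cast_zero] at b
      rw [b]; exact e)).2
    omega
  have e1 : X.Tinv^[m + 1] (X.sep i) = X.sep j := by
    rw [Function.iterate_succ_apply', ← hj, X.hinv_left _ (X.sep_mem j)]
  by_cases hj0 : (j : ℕ) = 0
  · obtain ⟨q, hq, eq⟩ := X.exists_l hs hreg
    apply hns q hq (m + 1)
    rw [Function.iterate_succ_apply', e1, X.sep_zero j hj0, ← eq, X.hinv_left _ (X.sep_mem q)]
  · exact hns j hj0 m e1

lemma iter_hc {d : ℕ} {u : ℝ} (h : PT d X.l X.r X.T X.Tinv X.SP u)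
    (h' : PT d X.l X.r X.Tinv X.T X.SQ u) (i : Fin s) (k : ℤ) :
    HC d (X.iter k (X.sep i)) (u + |(k : ℝ)| * u) := by
  have hp : HC d (X.sep i) u := h.hP _ (by simp [SP])
  obtain ⟨n, rfl | rfl⟩ := Int.eq_nat_or_neg k
  · rw [X.iter_nat]
    have := hp.add (h.ittr n (X.sep_mem i))
    simpa using this
  · rw [X.iter_neg]
    have := hp.add (h'.ittr n (X.sep_mem i))
    simpa using this

/-- With one interval there are no admissible semi-intervals. -/
lemma no_adm (hs : s < 2) (u v : ℝ) : ¬ X.Admissible u v := by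
  rintro ⟨h1, h2, h3, h4, -⟩
  simp only [Div, Set.mem_iUnion] at h4
  obtain ⟨i, k, hk1, hk2, hk⟩ := h4
  have hi0 : (i : ℕ) = 0 := by omega
  have hl := X.sep_zero i hi0
  have hII : ∀ x ∈ Ico X.l X.r, X.T x = x + X.α i := by
    intro x hx
    obtain ⟨j, hj⟩ := X.locate hx
    have : j = i := by ext; omega
    subst this
    exact X.hT j x hj
  have hlI : X.l ∈ Ico X.l X.r := ⟨le_rfl, X.hlr⟩
  have e1 := hII _ hlI
  have e2 := hII _ (X.hinvmaps hlI)
  rw [X.hinv_right _ hlI] at e2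
  have e3 := (X.hmaps hlI).1
  have e4 := (X.hinvmaps hlI).1
  have hT : X.T X.l = X.l := by linarith
  have hTi : X.Tinv X.l = X.l := by linarith
  have hP : X.rhoP u v (X.sep i) = 0 := by
    unfold rhoP
    have : {n : ℕ | 0 < n ∧ X.iter n (X.sep i) ∈ Ioo u v} = ∅ := by
      ext n
      simp only [Set.mem_ofPred_eq, Set.mem_empty_iff_false, iff_false]
      rintro ⟨-, hn⟩
      rw [X.iter_nat, hl, Function.iterate_fixed hT] at hn
      linarith [hn.1]
    rw [this]; simp
  have hM : X.rhoM u v (X.sep i) = 0 := by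
    unfold rhoM
    have : {n : ℕ | X.iter (-(n : ℤ)) (X.sep i) ∈ Ioo u v} = ∅ := by
      ext n
      simp only [Set.mem_ofPred_eq, Set.mem_empty_iff_false, iff_false]
      intro hn
      rw [X.iter_neg, hl, Function.iterate_fixed hTi] at hn
      linarith [hn.1]
    rw [this]; simp
  rw [hP] at hk2
  rw [hM] at hk1
  simp at hk1 hk2
  omega

end IET

namespace IET

variable {s : ℕ} (X : IET s)

lemma hitting {d : ℕ} {w : ℝ} (hs : 2 ≤ s) (hreg : X.Regular) (hd : ¬ IsSquare d) (hd0 : 0 < d)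
    (hf : PT d X.l X.r X.T X.Tinv X.SP w) (hg : PT d X.l X.r X.Tinv X.T X.SQ w) :
    ∃ C3 : ℝ, 0 < C3 ∧ ∀ u v : ℝ, X.l ≤ u → u < v → v ≤ X.r → ∃ N : ℕ, N * (v - u) ≤ C3 ∧
      (∀ x ∈ Ico X.l X.r, ∃ i ≤ N, X.T^[i] x ∈ Ioo u v) ∧
      (∀ x ∈ Ico X.l X.r, ∃ i ≤ N, X.Tinv^[i] x ∈ Ioo u v) := by
  have hlr := X.hlr
  obtain ⟨K1, hK1, ret1⟩ := hf.ret hd hlr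
  obtain ⟨K2, hK2, ret2⟩ := hg.ret hd hlr
  obtain ⟨C1, hC1, happ⟩ := approx hd hd0 (|X.l| + |X.r|) (X.r - X.l) (by positivity) (by linarith)
  set C2 : ℝ := 8 * C1 + (X.r - X.l) with hC2
  have hC2pos : 0 < C2 := by linarith
  refine ⟨(K1 + K2) * C2, by positivity, ?_⟩
  intro u v hu huv hv
  have hpos : 0 < v - u := by linarith
  have habs : ∀ x, X.l ≤ x → x ≤ X.r → |x| ≤ |X.l| + |X.r| := by
    intro x h1 h2
    rw [abs_le]
    constructor
    · linarith [neg_abs_le X.l, abs_nonneg X.r]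
    · linarith [le_abs_self X.r, abs_nonneg X.l]
  obtain ⟨z1, a1, b1⟩ := happ (u + (v - u) / 4) (habs _ (by linarith) (by linarith)) ((v - u) / 8)
    (by linarith) (by linarith)
  obtain ⟨z2, a2, b2⟩ := happ (v - (v - u) / 4) (habs _ (by linarith) (by linarith)) ((v - u) / 8)
    (by linarith) (by linarith)
  rw [abs_lt] at a1 a2
  have hn0 : 1 ≤ C2 / (v - u) := by
    rw [le_div_iff₀ hpos]; linarith
  have hn1 : C1 / ((v - u) / 8) ≤ C2 / (v - u) := by
    have : C1 / ((v - u) / 8) = 8 * C1 / (v - u) := by field_simp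
    rw [this]
    gcongr
    linarith
  have b1' := b1.mono hn1
  have b2' := b2.mono hn1
  set n0 := C2 / (v - u) with hn0def
  have hK1n : K1 * n0 ≤ (K1 + K2) * n0 := by nlinarith
  have hK2n : K2 * n0 ≤ (K1 + K2) * n0 := by nlinarith
  set N : ℕ := ⌊(K1 + K2) * n0⌋₊ with hN
  have hNle : (N : ℝ) ≤ (K1 + K2) * n0 := Nat.floor_le (by positivity)
  have hl1 : X.l ≤ z1 := by linarith [a1.1]
  have h12 : z1 < z2 := by linarith [a1.2, a2.1]
  have h2r : z2 ≤ X.r := by linarith [a2.2]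
  have hsub : ∀ x, x ∈ Ico z1 z2 → x ∈ Ioo u v := by
    intro x hx
    exact ⟨by linarith [hx.1, a1.1], by linarith [hx.2, a2.2]⟩
  have hd1 := PT.dense hf hg (X.nonper hs hreg hf) (X.noconn hs hreg hf) hl1 h12 h2r N
    (by
      intro z hz hzJ
      by_contra hcon
      push Not at hcon
      have := ret1 n0 hn0 z1 z2 b1' b2' z hz hzJ (N + 1) (fun i hi _ => hcon i hi)
      have := Nat.le_floor (this.trans hK1n)
      omega)
    (by
      intro z hz hzJ R hR
      have := ret2 n0 hn0 z1 z2 b1' b2' z hz hzJ R hR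
      exact Nat.le_floor (this.trans hK2n))
  refine ⟨N, ?_, ?_, ?_⟩
  · calc (N : ℝ) * (v - u) ≤ (K1 + K2) * n0 * (v - u) := by gcongr
      _ = (K1 + K2) * C2 := by rw [hn0def]; field_simp
  · intro x hx
    obtain ⟨i, hi, hi'⟩ := hd1 x hx
    exact ⟨i, hi, hsub _ hi'⟩
  · intro x hx
    obtain ⟨i, hi, hi'⟩ := hd1 (X.Tinv^[N] x) (hf.itgm N hx)
    refine ⟨N - i, by omega, hsub _ ?_⟩
    have e : X.Tinv^[N] x = X.Tinv^[i] (X.Tinv^[N - i] x) := by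
      rw [← Function.iterate_add_apply]; congr 2; omega
    rw [e, hf.itfg i (hf.itgm _ hx)] at hi'
    exact hi'

end IET

/-- for a regular interval exchange transformation defined over
`ℤ[√d]`, the reduced complexity `Π(J) = |J|·Ψ(J)` of admissible semi-intervals
is bounded above and below by positive constants. -/
theorem iet_admissible_reduced_complexity_bounded {s : ℕ} (d : ℕ)
    (hd : Squarefree d) (hd2 : 2 ≤ d) (X : IET s) (hdef : X.DefinedOver (Zsd d))
    (hreg : X.Regular) :
    ∃ c C : ℝ, 0 < c ∧ c ≤ C ∧ ∀ u v : ℝ, X.Admissible u v →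
      c ≤ (v - u) * max (Psi d u) (Psi d v) ∧
      (v - u) * max (Psi d u) (Psi d v) ≤ C := by
  have hsq := sqrt_irr hd hd2
  by_cases hs : s < 2
  · exact ⟨1, 1, one_pos, le_rfl, fun u v h => (X.no_adm hs u v h).elim⟩
  push Not at hs
  obtain ⟨w, hf, hg⟩ := X.exists_PT hsq hdef
  obtain ⟨C3, hC3, hit⟩ := X.hitting hs hreg hsq (by omega) hf hg
  have hw := hf.hu
  have hlr := X.hlr
  have hsd := Real.sqrt_nonneg (d : ℝ)
  set c : ℝ := 1 / (2 * (1 + Real.sqrt d)) with hc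
  have hc0 : 0 < c := by positivity
  set C : ℝ := w * (2 * (X.r - X.l) + C3) with hC
  refine ⟨c, max c C, hc0, le_max_left _ _, ?_⟩
  intro u v hadm
  obtain ⟨h1, h2, h3, h4, h5⟩ := hadm
  have hpos : 0 < v - u := by linarith
  obtain ⟨N, hN, hNf, hNg⟩ := hit u v h1 h2 h3
  -- division points have complexity controlled by the hitting time
  have hdiv : ∀ y ∈ X.Div u v, HC d y (w * (2 + N)) := by
    intro y hy
    simp only [IET.Div, Set.mem_iUnion] at hy
    obtain ⟨i, k, hk1, hk2, rfl⟩ := hy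
    have hP : X.rhoP u v (X.sep i) ≤ N + 1 := by
      obtain ⟨j, hj, hj'⟩ := hNf (X.T (X.sep i)) (X.hmaps (X.sep_mem i))
      have hm : j + 1 ∈ {n : ℕ | 0 < n ∧ X.iter n (X.sep i) ∈ Ioo u v} := by
        refine ⟨Nat.succ_pos j, ?_⟩
        rw [X.iter_nat, Function.iterate_succ_apply]
        exact hj'
      exact (Nat.sInf_le hm).trans (by omega)
    have hM : X.rhoM u v (X.sep i) ≤ N := by
      obtain ⟨j, hj, hj'⟩ := hNg (X.sep i) (X.sep_mem i)
      refine (Nat.sInf_le (m := j) ?_).trans hj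
      change X.iter (-(j : ℤ)) (X.sep i) ∈ Ioo u v
      rw [X.iter_neg]
      exact hj'
    refine (X.iter_hc hf hg i k).mono ?_
    have hk : |k| ≤ N + 1 := by rw [abs_le]; omega
    have hk' : |(k : ℝ)| ≤ N + 1 := by exact_mod_cast hk
    have := mul_le_mul_of_nonneg_right hk' (by linarith : 0 ≤ w)
    linarith
  have hu : HC d u (w * (2 + N)) := hdiv u h4
  have hv : HC d v (w * (2 + N)) := by
    rcases h5 with h5 | h5
    · exact hdiv v h5
    · rw [h5]
      refine hf.hr.mono ?_
      have : (0 : ℝ) ≤ N := by positivity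
      nlinarith
  constructor
  · have e1 := ((hc_psi hsq hv.mem).sub (hc_psi hsq hu.mem)).lower hsq hpos
    rw [hc, div_le_iff₀ (by positivity)]
    refine e1.trans ?_
    have e2 : Psi d v + Psi d u ≤ 2 * max (Psi d u) (Psi d v) := by
      linarith [le_max_left (Psi d u) (Psi d v), le_max_right (Psi d u) (Psi d v)]
    calc (v - u) * ((1 + Real.sqrt d) * (Psi d v + Psi d u))
        ≤ (v - u) * ((1 + Real.sqrt d) * (2 * max (Psi d u) (Psi d v))) := by gcongr
      _ = _ := by ring
  · refine le_trans ?_ (le_max_right _ _)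
    calc (v - u) * max (Psi d u) (Psi d v) ≤ (v - u) * (w * (2 + N)) := by
          gcongr; exact max_le hu.psi_le hv.psi_le
      _ = w * (2 * (v - u) + N * (v - u)) := by ring
      _ ≤ w * (2 * (X.r - X.l) + C3) := by
          gcongr
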